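/- arXiv:2204.06368 — 2 statements merged into one kernel-verified Lean document; each statement's English description precedes it below -/
import Mathlib

section
/- Let $k$ be a field of characteristic $\neq 2$ and let $q$ be an anisotropic quadratic form over $k$. Then for any $r \geq 1$, the quadratic form $\langle\langle x_1, \ldots, x_r \rangle\rangle \otimes q$ is anisotropic over the rational function field $k(x_1, \ldots, x_r)$. -/
/-- A diagonal quadratic form (given by its diagonal entries `d`) is anisotropic. -/
def Anisotropic {F : Type*} [Field F] {ι : Type*} [Fintype ι] (d : ι → F) : Prop :=
  ∀ w : ι → F, ∑ i, d i * w i ^ 2 = 0 → w = 0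

/-- The parity of the exponents of `x ^ S * x ^ (2 a)` recovers both `S` and `a`. -/
lemma indicator_add_two_nsmul_inj {σ : Type*} {S T : Finset σ} {a b : σ →₀ ℕ}
    (h : ∑ i ∈ S, Finsupp.single i 1 + (a + a) = ∑ i ∈ T, Finsupp.single i 1 + (b + b)) :
    S = T ∧ a = b := by
  classical
  have key (i : σ) : (if i ∈ S then 1 else 0) + (a i + a i) =
      (if i ∈ T then 1 else 0) + (b i + b i) := by
    simpa [Finsupp.finsetSum_apply, Finsupp.single_apply] using DFunLike.congr_fun h i
  constructor <;> ext i <;> have := key i <;> split_ifs at this <;> first | omega | simp_all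

lemma prod_X_mul_C_eq_monomial {σ R : Type*} [CommSemiring R] (S : Finset σ) (c : R) :
    (∏ i ∈ S, MvPolynomial.X i) * MvPolynomial.C c =
      MvPolynomial.monomial (∑ i ∈ S, Finsupp.single i 1) c := by
  rw [← mul_one c, ← MvPolynomial.C_mul_monomial, MvPolynomial.monomial_sum_one, mul_one, mul_comm]
  rfl

lemma MonomialOrder.degree_monomial_mul_sq_le {σ R : Type*} [CommSemiring R] (m : MonomialOrder σ)
    (e : σ →₀ ℕ) (c : R) (f : MvPolynomial σ R) :
    m.toSyn (m.degree (MvPolynomial.monomial e c * f ^ 2)) ≤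
      m.toSyn (e + (m.degree f + m.degree f)) := by
  rw [sq]
  refine m.degree_mul_le.trans ?_
  rw [map_add, map_add]
  exact add_le_add (m.degree_monomial_le c) m.degree_mul_le

lemma MonomialOrder.coeff_monomial_mul_sq {σ R : Type*} [CommSemiring R] (m : MonomialOrder σ)
    (e a : σ →₀ ℕ) (c : R) {f : MvPolynomial σ R} (h : m.toSyn (m.degree f) ≤ m.toSyn a) :
    (MvPolynomial.monomial e c * f ^ 2).coeff (e + (a + a)) = c * f.coeff a ^ 2 := by
  rw [MvPolynomial.coeff_monomial_mul, sq, m.coeff_mul_of_add_of_degree_le h h, sq]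

/-- Anisotropy of `⟨⟨x₁, …, x_r⟩⟩ ⊗ q` over the polynomial ring. -/
lemma Anisotropic.eq_zero_of_sum_monomial_mul_sq {σ k ι : Type*} [Field k] [Fintype σ] [Fintype ι]
    (m : MonomialOrder σ) {d : ι → k} (hq : Anisotropic d)
    (f : Finset σ × ι → MvPolynomial σ k)
    (hf : ∑ p, MvPolynomial.monomial (∑ i ∈ p.1, Finsupp.single i 1) (d p.2) * f p ^ 2 = 0) :
    f = 0 := by
  classical
  by_contra hne
  obtain ⟨p₁, hp₁⟩ := Function.ne_iff.mp hne
  let ε (p : Finset σ × ι) : σ →₀ ℕ := ∑ i ∈ p.1, Finsupp.single i 1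
  let E (p : Finset σ × ι) : σ →₀ ℕ := ε p + (m.degree (f p) + m.degree (f p))
  obtain ⟨⟨S, j₀⟩, hp₀, hmax⟩ := Finset.exists_max_image (Finset.univ.filter fun p => f p ≠ 0)
    (fun p => m.toSyn (E p)) ⟨p₁, by simpa using hp₁⟩
  replace hp₀ : f (S, j₀) ≠ 0 := by simpa using hp₀
  set a := m.degree (f (S, j₀)) with ha
  have hdeg (j : ι) : m.toSyn (m.degree (f (S, j))) ≤ m.toSyn a := by
    by_cases hj : f (S, j) = 0
    · simp [hj]
    have h := hmax (S, j) (by simpa using hj)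
    simp only [E, ε, map_add, add_le_add_iff_left, ← ha] at h
    by_contra! hlt
    exact absurd h (not_le.mpr (add_lt_add hlt hlt))
  have hcoeff (p : Finset σ × ι) (hp : p.1 ≠ S) :
      (MvPolynomial.monomial (ε p) (d p.2) * f p ^ 2).coeff (E (S, j₀)) = 0 := by
    by_cases hfp : f p = 0
    · simp [hfp]
    refine m.coeff_eq_zero_of_lt ((m.degree_monomial_mul_sq_le _ _ _).trans_lt ?_)
    refine lt_of_le_of_ne (hmax p (by simpa using hfp)) fun h => hp ?_
    exact (indicator_add_two_nsmul_inj (m.toSyn.injective h)).1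
  have hsum : ∑ j, d j * (f (S, j)).coeff a ^ 2 = 0 := by
    have h := congrArg (MvPolynomial.coeff (E (S, j₀))) hf
    rw [MvPolynomial.coeff_sum, Fintype.sum_prod_type, Finset.sum_eq_single S
      (fun T _ hT => Finset.sum_eq_zero fun j _ => hcoeff (T, j) hT) (by simp)] at h
    rw [MvPolynomial.coeff_zero] at h
    rw [← h]
    exact Finset.sum_congr rfl fun j _ => (m.coeff_monomial_mul_sq _ a (d j) (hdeg j)).symm
  exact m.coeff_degree_ne_zero_iff.mpr hp₀ (congrFun (hq _ hsum) j₀)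

/-- if `q = ⟨d 0, …, d (n-1)⟩` is anisotropic over `k` (char ≠ 2), then for
any `r ≥ 1`, the form `⟨⟨x₁, …, x_r⟩⟩ ⊗ q` (with diagonal entries `(∏_{i ∈ S} x_i) · d j`
for `S ⊆ {1, …, r}`, `1 ≤ j ≤ n`) is anisotropic over `k(x₁, …, x_r)`. -/
theorem pfister_tensor_anisotropic_over_rational_function_field
    {k : Type*} [Field k] (hk : (2 : k) ≠ 0) {n : ℕ} (d : Fin n → k)
    (hq : Anisotropic d) (r : ℕ) (hr : 1 ≤ r) :
    Anisotropic (fun p : Finset (Fin r) × Fin n =>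
      (∏ i ∈ p.1, algebraMap (MvPolynomial (Fin r) k)
          (FractionRing (MvPolynomial (Fin r) k)) (MvPolynomial.X i)) *
        algebraMap (MvPolynomial (Fin r) k)
          (FractionRing (MvPolynomial (Fin r) k)) (MvPolynomial.C (d p.2))) := by
  intro w hw
  obtain ⟨b, hb⟩ := IsLocalization.exist_integer_multiples_of_finite
    (nonZeroDivisors (MvPolynomial (Fin r) k)) w
  choose f hf using hb
  have hinj := IsFractionRing.injective (MvPolynomial (Fin r) k)
    (FractionRing (MvPolynomial (Fin r) k))
  have hf0 : f = 0 := by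
    refine hq.eq_zero_of_sum_monomial_mul_sq MonomialOrder.lex f (hinj ?_)
    simp_rw [← prod_X_mul_C_eq_monomial, map_sum, map_mul, map_pow, map_prod, hf, Algebra.smul_def,
      mul_pow, mul_left_comm _ (algebraMap _ _ _ ^ 2), ← Finset.mul_sum]
    rw [hw, mul_zero, map_zero]
  ext p
  have h := hf p
  rw [hf0, Pi.zero_apply, map_zero, Algebra.smul_def, eq_comm, mul_eq_zero] at h
  exact h.resolve_left (IsFractionRing.to_map_ne_zero_of_mem_nonZeroDivisors b.2)
end

section
/- Let $k$ be a field of characteristic $\neq 2$, $r \geq 2$, and for $1 \leq i \leq r$ let $g_i(x_i) \in k[x_i]$ have positive degree with $g_i(0) \in k^{\times 2}$. Set $f_r = \prod_{i=1}^r x_i g_i(x_i)$ and suppose the twisted Pfister form $q_r = \langle\langle x_1, \ldots, x_r; f_r \rangle\rangle$ is anisotropic over $K_r = k(x_1, \ldots, x_r)$. Then the $(2^r+1)$-dimensional quadratic form $\widetilde{q}_r = q_r \perp \langle -x_{r+1}^2 - x_1 \cdots x_r \rangle$ is anisotropic over $K_{r+1} = k(x_1, \ldots, x_{r+1})$. 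-/
noncomputable section

/-- The rational function field `k(x₁, …, x_m)`. -/
abbrev Km (k : Type*) [Field k] (m : ℕ) := FractionRing (MvPolynomial (Fin m) k)

/-- The variable `xᵢ` in `k(x₁, …, x_m)`. -/
def xvar {k : Type*} [Field k] {m : ℕ} (i : Fin m) : Km k m :=
  algebraMap (MvPolynomial (Fin m) k) (Km k m) (MvPolynomial.X i)

/-- `gᵢ(xᵢ)` as an element of `k(x₁, …, x_m)`. -/
def gval {k : Type*} [Field k] {m : ℕ} (g : Polynomial k) (i : Fin m) : Km k m :=
  algebraMap (MvPolynomial (Fin m) k) (Km k m)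
    (Polynomial.aeval (MvPolynomial.X i : MvPolynomial (Fin m) k) g)

/-- The diagonal entries of the twisted Pfister form `⟨⟨x₁, …, x_r; f_r⟩⟩` over
`k(x₁, …, x_r)`, where `f_r = ∏ᵢ xᵢ gᵢ(xᵢ)`: the entry indexed by `S ⊆ {1, …, r}` is
`∏_{i ∈ S} xᵢ`, except that the last entry (for `S` the full set) is multiplied by `f_r`. -/
def twistedEntries {k : Type*} [Field k] {r : ℕ} (g : Fin r → Polynomial k)
    (S : Finset (Fin r)) : Km k r :=
  (∏ i ∈ S, xvar (k := k) i) *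
    (if S = Finset.univ then ∏ i, xvar (k := k) i * gval (g i) i else 1)

open Polynomial in
theorem natDegree_le_of_anisotropic {F ι : Type*} [Field F] [Fintype ι] {d : ι → F}
    (hd : Anisotropic d) {w : ι → F[X]} {m : ℕ}
    (hm : (∑ i, C (d i) * w i ^ 2).natDegree ≤ 2 * m) (i : ι) : (w i).natDegree ≤ m := by
  obtain ⟨j, -, hj⟩ := Finset.exists_max_image Finset.univ (fun i => (w i).natDegree)
    ⟨i, Finset.mem_univ i⟩
  refine (hj i (Finset.mem_univ i)).trans ?_
  by_contra! hlt
  have hcoeff : (∑ i, C (d i) * w i ^ 2).coeff (2 * (w j).natDegree)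
      = ∑ i, d i * (w i).coeff (w j).natDegree ^ 2 := by
    rw [finsetSum_coeff]
    refine Finset.sum_congr rfl fun l _ => ?_
    rw [coeff_C_mul, coeff_pow_of_natDegree_le (hj l (Finset.mem_univ l))]
  rw [coeff_eq_zero_of_natDegree_lt (by lia)] at hcoeff
  have h0 := congrFun (hd _ hcoeff.symm) j
  have hw : w j = 0 := leadingCoeff_eq_zero.mp h0
  simp [hw] at hlt

open Polynomial in
theorem eq_zero_of_anisotropic {F ι : Type*} [Field F] [Fintype ι] {d : ι → F}
    (hd : Anisotropic d) {w : ι → F[X]} (h : ∑ i, C (d i) * w i ^ 2 = 0) : w = 0 := by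
  have hdeg (i : ι) : w i = C ((w i).coeff 0) :=
    eq_C_of_natDegree_le_zero (natDegree_le_of_anisotropic hd (m := 0) (by simp [h]) i)
  have h0 : ∑ i, d i * (w i).coeff 0 ^ 2 = 0 := by
    have := congrArg (eval 0) h
    simpa [eval_finsetSum, coeff_zero_eq_eval_zero] using this
  funext i
  rw [hdeg i, show (w i).coeff 0 = 0 from congrFun (hd _ h0) i, C_0, Pi.zero_apply]

open Polynomial in
/-- The Cassels–Pfister theorem for anisotropic diagonal forms. -/
theorem cassels_pfister {F ι : Type*} [Field F] [Fintype ι] {d : ι → F}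
    (hd : Anisotropic d) (p v : F[X]) (hv : v ≠ 0) (w : ι → F[X])
    (h : ∑ i, C (d i) * w i ^ 2 = p * v ^ 2) :
    ∃ u : ι → F[X], ∑ i, C (d i) * u i ^ 2 = p := by
  induction hn : v.natDegree using Nat.strong_induction_on generalizing v w with
  | _ n ih =>
  set u : ι → F[X] := fun i => w i / v with hu
  set ρ : ι → F[X] := fun i => w i % v with hρ
  have hwi (i : ι) : w i = v * u i + ρ i := (EuclideanDomain.div_add_mod (w i) v).symm
  by_cases hρ0 : ρ = 0
  · refine ⟨u, mul_right_cancel₀ (pow_ne_zero 2 hv) ?_⟩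
    rw [← h, Finset.sum_mul]
    refine Finset.sum_congr rfl fun i _ => ?_
    rw [hwi i, hρ0, Pi.zero_apply]
    ring
  have hpos : 0 < n := by
    rw [← hn]
    by_contra! h0
    refine hρ0 (funext fun i => ?_)
    have hunit : IsUnit v := isUnit_iff_degree_eq_zero.mpr
      (by rw [degree_eq_natDegree hv]; simp; lia)
    exact (EuclideanDomain.mod_eq_zero).mpr hunit.dvd
  set A := ∑ i, C (d i) * u i ^ 2 with hA
  set B := ∑ i, C (d i) * (w i * u i) with hB
  set R := ∑ i, C (d i) * ρ i ^ 2 with hR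
  have hRne : R ≠ 0 := fun h0 => hρ0 (eq_zero_of_anisotropic hd h0)
  have hRexp : R = p * v ^ 2 - 2 * v * B + v ^ 2 * A := by
    rw [← h, hR, hA, hB, Finset.mul_sum, Finset.mul_sum, ← Finset.sum_sub_distrib,
      ← Finset.sum_add_distrib]
    refine Finset.sum_congr rfl fun i _ => ?_
    rw [show ρ i = w i - v * u i by rw [hwi i]; ring]
    ring
  set v' := (A - p) * v + 2 * (p * v - B) with hv'
  have hvv' : v * v' = R := by rw [hRexp, hv']; ring
  have hv'ne : v' ≠ 0 := fun h0 => hRne (by rw [← hvv', h0, mul_zero])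
  have hρdeg (i : ι) : (ρ i).natDegree ≤ n - 1 := by
    have : (ρ i).natDegree < v.natDegree := natDegree_mod_lt _ (by lia)
    lia
  have hRdeg : R.natDegree ≤ 2 * (n - 1) := by
    refine natDegree_sum_le_of_forall_le _ _ fun i _ => ?_
    refine (natDegree_C_mul_le _ _).trans (natDegree_pow_le.trans ?_)
    have := hρdeg i
    lia
  have hlt : v'.natDegree < n := by
    have := natDegree_mul hv hv'ne
    rw [hvv'] at this
    lia
  refine ih _ hlt v' hv'ne (fun i => (A - p) * w i + 2 * (p * v - B) * u i) ?_ rfl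
  have hexp : ∑ i, C (d i) * ((A - p) * w i + 2 * (p * v - B) * u i) ^ 2
      = (A - p) ^ 2 * (p * v ^ 2) + 2 * ((A - p) * (2 * (p * v - B))) * B
        + (2 * (p * v - B)) ^ 2 * A := by
    rw [← h, hA, hB]
    simp only [Finset.mul_sum]
    rw [← Finset.sum_add_distrib, ← Finset.sum_add_distrib]
    refine Finset.sum_congr rfl fun i _ => ?_
    rw [← hA, ← hB]
    ring
  rw [hexp, hv']
  ring

/-- If `q = ⟨1⟩ ⊥ q'` and `q' ⊥ ⟨-c⟩` are anisotropic, then no vector of value `c` is orthogonal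
to a vector of value `1`. -/
theorem not_orthogonal_of_anisotropic_update {F ι : Type*} [Field F] [Fintype ι] [DecidableEq ι]
    {d : ι → F} (hd : Anisotropic d) {i₀ : ι} (hi₀ : d i₀ = 1) {c : F}
    (hc : Anisotropic (Function.update d i₀ (-c))) (a b : ι → F)
    (haa : ∑ i, d i * a i ^ 2 = 1) (hab : ∑ i, d i * (a i * b i) = 0)
    (hbb : ∑ i, d i * b i ^ 2 = c) : False := by
  suffices H : ∃ b' : ι → F, b' i₀ = 0 ∧ ∑ i, d i * b' i ^ 2 = c by
    obtain ⟨b', h0, hb'⟩ := H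
    have := hc (Function.update b' i₀ 1) (by
      rw [← Finset.add_sum_erase _ _ (Finset.mem_univ i₀)] at hb' ⊢
      rw [Finset.sum_congr rfl (g := fun i => d i * b' i ^ 2) fun i hi => by
        simp [Function.update_of_ne (Finset.ne_of_mem_erase hi)]]
      simp only [h0, Function.update_self] at hb' ⊢
      linear_combination hb')
    simpa using congrFun this i₀
  set e : ι → F := Pi.single i₀ 1 with he
  have hpair (f : ι → F) : ∑ i, d i * (e i * f i) = f i₀ := by
    rw [Finset.sum_eq_single i₀ (fun i _ hi => by simp [he, hi]) (by simp)]
    simp [he, hi₀]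
  have hee : ∑ i, d i * e i ^ 2 = 1 := by
    simpa [he, sq] using hpair e
  have hN : ∑ i, d i * (a i - e i) ^ 2 = 2 * (1 - a i₀) := by
    have : ∑ i, d i * (a i - e i) ^ 2
        = ∑ i, d i * a i ^ 2 - 2 * ∑ i, d i * (e i * a i) + ∑ i, d i * e i ^ 2 := by
      rw [Finset.mul_sum, ← Finset.sum_sub_distrib, ← Finset.sum_add_distrib]
      exact Finset.sum_congr rfl fun i _ => by ring
    rw [this, haa, hpair, hee]
    ring
  by_cases h1 : a i₀ = 1
  · have hae : (fun i => a i - e i) = 0 := hd _ (by rw [hN, h1]; ring)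
    refine ⟨b, ?_, hbb⟩
    rw [← hpair b, ← hab]
    exact Finset.sum_congr rfl fun i _ => by rw [sub_eq_zero.mp (congrFun hae i)]
  · have h1' : 1 - a i₀ ≠ 0 := sub_ne_zero.mpr (Ne.symm h1)
    set l := b i₀ / (1 - a i₀) with hl
    have hl' : l * (1 - a i₀) = b i₀ := div_mul_cancel₀ _ h1'
    refine ⟨fun i => b i + l * (a i - e i), ?_, ?_⟩
    · simp only [he, Pi.single_eq_same]
      linear_combination -hl'
    · have : ∑ i, d i * (b i + l * (a i - e i)) ^ 2
          = ∑ i, d i * b i ^ 2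
            + 2 * l * (∑ i, d i * (a i * b i) - ∑ i, d i * (e i * b i))
            + l ^ 2 * ∑ i, d i * (a i - e i) ^ 2 := by
        rw [← Finset.sum_sub_distrib, Finset.mul_sum, Finset.mul_sum, ← Finset.sum_add_distrib,
          ← Finset.sum_add_distrib]
        exact Finset.sum_congr rfl fun i _ => by ring
      rw [this, hbb, hab, hpair, hN]
      linear_combination 2 * l * hl'

open Polynomial in
/-- If `q = ⟨1⟩ ⊥ q'` and `q' ⊥ ⟨-c⟩` are anisotropic over `F`, then `q` does not represent
`t² + c` over `F(t)`. -/
theorem eq_zero_of_eq_sq_add_mul_sq {F ι : Type*} [Field F] [Fintype ι] [DecidableEq ι]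
    (h2 : (2 : F) ≠ 0) {d : ι → F} (hd : Anisotropic d) {i₀ : ι} (hi₀ : d i₀ = 1) {c : F}
    (hc : Anisotropic (Function.update d i₀ (-c))) (w : ι → F[X]) (v : F[X])
    (h : ∑ i, C (d i) * w i ^ 2 = (X ^ 2 + C c) * v ^ 2) : v = 0 := by
  by_contra hv
  obtain ⟨u, hu⟩ := cassels_pfister hd _ v hv w h
  have hdeg (i : ι) : (u i).natDegree ≤ 1 :=
    natDegree_le_of_anisotropic hd (by rw [hu]; compute_degree) i
  have hexp : C (∑ i, d i * (u i).coeff 1 ^ 2) * X ^ 2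
      + C (2 * ∑ i, d i * ((u i).coeff 1 * (u i).coeff 0)) * X
      + C (∑ i, d i * (u i).coeff 0 ^ 2) = X ^ 2 + C c := by
    rw [← hu]
    simp only [map_sum, map_mul, map_pow, Finset.mul_sum, Finset.sum_mul]
    rw [← Finset.sum_add_distrib, ← Finset.sum_add_distrib]
    refine Finset.sum_congr rfl fun i _ => ?_
    conv_rhs => rw [eq_X_add_C_of_natDegree_le_one (hdeg i)]
    simp only [map_ofNat]
    ring
  have hcoeffs : ∀ a b e : F, C a * X ^ 2 + C (2 * b) * X + C e = X ^ 2 + C c →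
      a = 1 ∧ b = 0 ∧ e = c := by
    intro a b e habe
    refine ⟨?_, ?_, ?_⟩
    · simpa [coeff_X, coeff_C] using congrArg (coeff · 2) habe
    · simpa [coeff_X, coeff_C, coeff_X_pow, h2, mul_assoc, -map_mul]
        using congrArg (coeff · 1) habe
    · simpa using congrArg (coeff · 0) habe
  obtain ⟨haa, hab, hbb⟩ := hcoeffs _ _ _ hexp
  exact not_orthogonal_of_anisotropic_update hd hi₀ hc _ _ haa hab hbb

theorem anisotropic_of_integral {R K ι : Type*} [CommRing R] [IsDomain R] [Field K] [Algebra R K]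
    [IsFractionRing R K] [Fintype ι] {D : ι → R}
    (hD : ∀ w : ι → R, ∑ i, D i * w i ^ 2 = 0 → w = 0) :
    Anisotropic fun i => algebraMap R K (D i) := by
  intro w hw
  obtain ⟨b, hb⟩ := IsLocalization.exist_integer_multiples_of_finite (nonZeroDivisors R) w
  choose p hp using hb
  have hb0 : algebraMap R K b ≠ 0 := IsFractionRing.to_map_ne_zero_of_mem_nonZeroDivisors b.2
  have hp0 : p = 0 := hD p (IsFractionRing.injective R K (by
    have : ∑ i, algebraMap R K (D i) * algebraMap R K (p i) ^ 2
        = algebraMap R K b ^ 2 * ∑ i, algebraMap R K (D i) * w i ^ 2 := by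
      rw [Finset.mul_sum]
      refine Finset.sum_congr rfl fun i _ => ?_
      rw [hp i, Algebra.smul_def]
      ring
    simpa [hw] using this))
  funext i
  have := hp i
  rw [hp0, Pi.zero_apply, map_zero, Algebra.smul_def] at this
  exact (mul_eq_zero.mp this.symm).resolve_left hb0

namespace MvPowerSeries

variable {σ R : Type*} [LinearOrder σ] [WellFoundedGT σ]

theorem lexOrder_eq_of_coeff [Semiring R] {φ : MvPowerSeries σ R} {e : σ →₀ ℕ}
    (he : coeff e φ ≠ 0) (hlt : ∀ f : σ →₀ ℕ, toLex f < toLex e → coeff f φ = 0) :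
    lexOrder φ = toLex e :=
  le_antisymm (lexOrder_le_of_coeff_ne_zero he)
    (le_lexOrder_iff.mpr fun f hf => hlt f (WithTop.coe_lt_coe.mp hf))

theorem lexOrder_eq_zero_of_constantCoeff_ne_zero [Semiring R] {φ : MvPowerSeries σ R}
    (h : constantCoeff φ ≠ 0) : lexOrder φ = toLex (0 : σ →₀ ℕ) :=
  lexOrder_eq_of_coeff (by simpa using h) fun _ hf => absurd hf not_lt_bot

theorem lexOrder_X [Semiring R] [Nontrivial R] (s : σ) :
    lexOrder (X s : MvPowerSeries σ R) = toLex (Finsupp.single s 1) := by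
  classical
  refine lexOrder_eq_of_coeff (by simp) fun f hf => ?_
  rw [coeff_X, if_neg]
  rintro rfl
  exact lt_irrefl _ hf

theorem lexOrder_prod [CommRing R] [IsDomain R] {ι : Type*} (s : Finset ι)
    (φ : ι → MvPowerSeries σ R) (e : ι → σ →₀ ℕ) (h : ∀ i ∈ s, lexOrder (φ i) = toLex (e i)) :
    lexOrder (∏ i ∈ s, φ i) = toLex (∑ i ∈ s, e i) := by
  classical
  induction s using Finset.induction_on with
  | empty => exact lexOrder_eq_zero_of_constantCoeff_ne_zero (by simp)
  | insert i s hi ih =>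
    rw [Finset.prod_insert hi, Finset.sum_insert hi, lexOrder_mul, h i (Finset.mem_insert_self i s),
      ih fun j hj => h j (Finset.mem_insert_of_mem hj), toLex_add, WithTop.coe_add]

/-- A diagonal form whose entries have lowest exponents pairwise distinct modulo `2` has no
nontrivial zero. -/
theorem eq_zero_of_sum_mul_sq_eq_zero [CommRing R] [IsDomain R] {ι : Type*} [Fintype ι]
    {D : ι → MvPowerSeries σ R} {e : ι → σ →₀ ℕ} (hD : ∀ i, lexOrder (D i) = toLex (e i))
    (he : ∀ i j, (∀ s, e i s % 2 = e j s % 2) → i = j)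
    {w : ι → MvPowerSeries σ R} (hw : ∑ i, D i * w i ^ 2 = 0) : w = 0 := by
  by_contra hne
  obtain ⟨l, hl⟩ := Function.ne_iff.mp hne
  obtain ⟨j, -, hj⟩ := Finset.exists_min_image Finset.univ
    (fun i => lexOrder (D i * w i ^ 2)) ⟨l, Finset.mem_univ l⟩
  have hord (i : ι) {f : σ →₀ ℕ} (hf : lexOrder (w i) = toLex f) :
      lexOrder (D i * w i ^ 2) = toLex (e i + (f + f)) := by
    rw [sq, lexOrder_mul, lexOrder_mul, hD, hf, toLex_add, toLex_add, WithTop.coe_add,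
      WithTop.coe_add]
  have hwj : w j ≠ 0 := by
    intro h0
    obtain ⟨f, hf⟩ := exists_finsupp_eq_lexOrder_of_ne_zero hl
    have := hj l (Finset.mem_univ l)
    simp [h0, hord l hf] at this
  obtain ⟨f, hf⟩ := exists_finsupp_eq_lexOrder_of_ne_zero hwj
  have hcoeff := congrArg (coeff (e j + (f + f))) hw
  rw [map_sum, Finset.sum_eq_single j, map_zero] at hcoeff
  · exact coeff_ne_zero_of_lexOrder (hord j hf).symm hcoeff
  · intro i _ hij
    refine coeff_eq_zero_of_lt_lexOrder ((hord j hf).symm.trans_lt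
      (lt_of_le_of_ne (hj i (Finset.mem_univ i)) fun heq => hij ?_))
    have hwi : w i ≠ 0 := by
      intro h0
      simp [h0, hord j hf] at heq
    obtain ⟨f', hf'⟩ := exists_finsupp_eq_lexOrder_of_ne_zero hwi
    rw [hord j hf, hord i hf', WithTop.coe_inj, toLex_inj] at heq
    refine he i j fun s => ?_
    have := DFunLike.congr_fun heq s
    simp only [Finsupp.add_apply] at this
    lia
  · simp

end MvPowerSeries

/-- The polynomial whose image in `k(x₁, …, x_r)` is the entry `S` of the twisted Pfister form. -/
def twistedPoly {k : Type*} [Field k] {r : ℕ} (g : Fin r → Polynomial k) (S : Finset (Fin r)) :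
    MvPolynomial (Fin r) k :=
  (∏ i ∈ S, MvPolynomial.X i) *
    (if S = Finset.univ then
      ∏ i, MvPolynomial.X i * Polynomial.aeval (MvPolynomial.X i : MvPolynomial (Fin r) k) (g i)
    else 1)

theorem algebraMap_twistedPoly {k : Type*} [Field k] {r : ℕ} (g : Fin r → Polynomial k)
    (S : Finset (Fin r)) :
    algebraMap (MvPolynomial (Fin r) k) (Km k r) (twistedPoly g S) = twistedEntries g S := by
  simp only [twistedPoly, twistedEntries, xvar, gval, map_mul, map_prod]
  split_ifs <;> simp

theorem algebraMap_rename_twistedPoly {k : Type*} [Field k] {r : ℕ} (g : Fin r → Polynomial k)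
    (S : Finset (Fin r)) :
    algebraMap (MvPolynomial (Fin (r + 1)) k) (Km k (r + 1))
        (MvPolynomial.rename Fin.castSucc (twistedPoly g S)) =
      (∏ i ∈ S, xvar (k := k) (m := r + 1) (Fin.castSucc i)) *
        (if S = Finset.univ then
          ∏ i : Fin r, xvar (k := k) (Fin.castSucc i) * gval (g i) (Fin.castSucc i)
        else 1) := by
  simp only [twistedPoly, xvar, gval, map_mul, map_prod, MvPolynomial.rename_X]
  split_ifs <;> simp [← Polynomial.aeval_algHom_apply]

open MvPowerSeries in
theorem lexOrder_twistedPoly {k : Type*} [Field k] {r : ℕ} (g : Fin r → Polynomial k)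
    (hg : ∀ i, (g i).eval 0 ≠ 0) (S : Finset (Fin r)) :
    lexOrder (twistedPoly g S : MvPowerSeries (Fin r) k) =
      toLex (∑ i ∈ S, Finsupp.single i 1 +
        if S = Finset.univ then ∑ i, Finsupp.single i 1 else 0 : Fin r →₀ ℕ) := by
  have hX (i : Fin r) : lexOrder ((MvPolynomial.X i : MvPolynomial (Fin r) k) :
      MvPowerSeries (Fin r) k) = toLex (Finsupp.single i 1) := by
    rw [MvPolynomial.coe_X, lexOrder_X]
  have hG (i : Fin r) : lexOrder ((Polynomial.aeval (MvPolynomial.X i : MvPolynomial (Fin r) k)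
      (g i) : MvPolynomial (Fin r) k) : MvPowerSeries (Fin r) k) = toLex (0 : Fin r →₀ ℕ) := by
    refine lexOrder_eq_zero_of_constantCoeff_ne_zero ?_
    rw [← coeff_zero_eq_constantCoeff_apply, MvPolynomial.coeff_coe,
      ← MvPolynomial.constantCoeff_eq, Polynomial.aeval_def, Polynomial.hom_eval₂]
    simpa [Polynomial.eval₂_eq_eval_map] using hg i
  simp only [← MvPolynomial.coeToMvPowerSeries.ringHom_apply] at hX hG ⊢
  rw [twistedPoly, map_mul, map_prod, lexOrder_mul, lexOrder_prod _ _ _ fun i _ => hX i,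
    toLex_add, WithTop.coe_add]
  congr 1
  split_ifs with h
  · rw [map_prod, lexOrder_prod _ _ (fun i => Finsupp.single i 1)]
    intro i _
    rw [map_mul, lexOrder_mul, hX, hG, ← WithTop.coe_add, ← toLex_add, add_zero]
  · rw [map_one]
    exact lexOrder_eq_zero_of_constantCoeff_ne_zero (by simp)

/-- A finset is determined by its indicator function, also after exchanging the indicator functions
of the empty and of the full set. -/
theorem eq_of_swapped_indicator_eq {α : Type*} [Fintype α] [DecidableEq α] [Nonempty α]
    {S T : Finset α}
    (h : ∀ s, (if S = ∅ then 1 else if S = Finset.univ then 0 else if s ∈ S then 1 else 0) =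
      if T = ∅ then 1 else if T = Finset.univ then 0 else if s ∈ T then 1 else 0) : S = T := by
  have hne : (Finset.univ : Finset α) ≠ ∅ := Finset.univ_nonempty.ne_empty
  rcases eq_or_ne S ∅ with rfl | hS <;> rcases eq_or_ne T ∅ with rfl | hT
  · rfl
  · simp only [if_true, hT, if_false] at h
    by_cases hT' : T = Finset.univ
    · simp [hT'] at h
    · exact absurd (Finset.eq_univ_iff_forall.mpr fun s => by simpa [hT'] using h s) hT'
  · simp only [if_true, hS, if_false] at h
    by_cases hS' : S = Finset.univ
    · simp [hS'] at h
    · exact absurd (Finset.eq_univ_iff_forall.mpr fun s => by simpa [hS'] using h s) hS'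
  · simp only [hS, hT, if_false] at h
    by_cases hS' : S = Finset.univ <;> by_cases hT' : T = Finset.univ
    · rw [hS', hT']
    · exact absurd (Finset.eq_empty_of_forall_notMem fun s => by simpa [hS', hT'] using h s) hT
    · exact absurd (Finset.eq_empty_of_forall_notMem fun s => by simpa [hS', hT'] using h s) hS
    · ext s
      have := h s
      simp only [hS', hT', if_false] at this
      by_cases h1 : s ∈ S <;> by_cases h2 : s ∈ T <;> simp_all

theorem anisotropic_update_twistedEntries {k : Type*} [Field k] {r : ℕ} (hr : 0 < r)
    (g : Fin r → Polynomial k) (hg : ∀ i, (g i).eval 0 ≠ 0) :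
    Anisotropic (Function.update (twistedEntries g) ∅ (-∏ i, xvar (k := k) (m := r) i)) := by
  have hne : (∅ : Finset (Fin r)) ≠ Finset.univ := by
    have : Nonempty (Fin r) := ⟨⟨0, hr⟩⟩
    exact Finset.univ_nonempty.ne_empty.symm
  have hD : Function.update (twistedEntries g) ∅ (-∏ i, xvar (k := k) (m := r) i) =
      fun S => algebraMap (MvPolynomial (Fin r) k) (Km k r)
        (Function.update (twistedPoly g) ∅ (-∏ i, MvPolynomial.X i) S) := by
    funext S
    rcases eq_or_ne S ∅ with rfl | hS
    · simp [xvar]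
    · simp [hS, algebraMap_twistedPoly]
  rw [hD]
  refine anisotropic_of_integral fun w hw => ?_
  have hw' := congrArg (MvPolynomial.coeToMvPowerSeries.ringHom (R := k)) hw
  simp only [map_sum, map_mul, map_pow, map_zero] at hw'
  have hzero := MvPowerSeries.eq_zero_of_sum_mul_sq_eq_zero
    (e := fun S => if S = ∅ then ∑ i, Finsupp.single i 1 else
      ∑ i ∈ S, Finsupp.single i 1 + if S = Finset.univ then ∑ i, Finsupp.single i 1 else 0)
    (fun S => ?_) (fun S T hST => ?_) hw'
  · funext S
    exact MvPolynomial.coe_injective _ _ ((congrFun hzero S).trans MvPolynomial.coe_zero.symm)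
  · by_cases hS : S = ∅
    · subst hS
      rw [if_pos rfl, Function.update_self, map_neg, map_prod, ← neg_one_mul,
        MvPowerSeries.lexOrder_mul,
        MvPowerSeries.lexOrder_eq_zero_of_constantCoeff_ne_zero (by simp),
        MvPowerSeries.lexOrder_prod _ _ (fun i => Finsupp.single i 1), ← WithTop.coe_add,
        ← toLex_add, zero_add]
      intro i _
      simp [MvPowerSeries.lexOrder_X]
    · rw [if_neg hS, Function.update_of_ne hS, MvPolynomial.coeToMvPowerSeries.ringHom_apply,
        lexOrder_twistedPoly g hg]
  · have hcoord (S : Finset (Fin r)) (s : Fin r) :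
        (∑ i ∈ S, Finsupp.single i 1 : Fin r →₀ ℕ) s = if s ∈ S then 1 else 0 := by
      classical
      simp [Finsupp.finsetSum_apply, Finsupp.single_apply]
    have hparity (S : Finset (Fin r)) (s : Fin r) :
        (if S = ∅ then ∑ i, Finsupp.single i 1 else ∑ i ∈ S, Finsupp.single i 1 +
          if S = Finset.univ then ∑ i, Finsupp.single i 1 else 0 : Fin r →₀ ℕ) s % 2 =
        if S = ∅ then 1 else if S = Finset.univ then 0 else if s ∈ S then 1 else 0 := by
      split_ifs <;> simp_all
    have : Nonempty (Fin r) := ⟨⟨0, hr⟩⟩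
    exact eq_of_swapped_indicator_eq fun s =>
      (hparity S s).symm.trans ((hST s).trans (hparity T s))

/-- The embedding `k[x₁, …, x_{r+1}] → k(x₁, …, x_r)[t]` sending the last variable to `t`. -/
def toPolynomialKm (k : Type*) [Field k] (r : ℕ) :
    MvPolynomial (Fin (r + 1)) k →+* Polynomial (Km k r) :=
  (Polynomial.mapRingHom (algebraMap (MvPolynomial (Fin r) k) (Km k r))).comp
    (((MvPolynomial.renameEquiv k finSuccEquivLast).trans
      (MvPolynomial.optionEquivLeft k (Fin r)) : _ ≃ₐ[k] _) : _ →+* _)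

theorem toPolynomialKm_injective (k : Type*) [Field k] (r : ℕ) :
    Function.Injective (toPolynomialKm k r) :=
  (Polynomial.map_injective _ (IsFractionRing.injective _ _)).comp (AlgEquiv.injective _)

theorem toPolynomialKm_X_last (k : Type*) [Field k] (r : ℕ) :
    toPolynomialKm k r (MvPolynomial.X (Fin.last r)) = Polynomial.X := by
  simp [toPolynomialKm]

theorem toPolynomialKm_rename {k : Type*} [Field k] {r : ℕ} (p : MvPolynomial (Fin r) k) :
    toPolynomialKm k r (MvPolynomial.rename Fin.castSucc p) =
      Polynomial.C (algebraMap (MvPolynomial (Fin r) k) (Km k r) p) := by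
  have : (toPolynomialKm k r).comp (MvPolynomial.rename Fin.castSucc).toRingHom =
      Polynomial.C.comp (algebraMap (MvPolynomial (Fin r) k) (Km k r)) := by
    ext : 2 <;> simp [toPolynomialKm]
  exact RingHom.congr_fun this p

/-- with `f_r = ∏_{i=1}^r xᵢ gᵢ(xᵢ)` (each `gᵢ` of positive degree and
`gᵢ(0)` a nonzero square), if the twisted Pfister form `q_r = ⟨⟨x₁, …, x_r; f_r⟩⟩` is
anisotropic over `K_r = k(x₁, …, x_r)`, then `q̃_r = q_r ⊥ ⟨-x_{r+1}² - x₁ ⋯ x_r⟩` is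
anisotropic over `K_{r+1} = k(x₁, …, x_{r+1})` (where `K_r ⊆ K_{r+1}` via
`xᵢ ↦ xᵢ` for `i ≤ r`). -/
theorem twisted_pfister_plus_entry_anisotropic
    {k : Type*} [Field k] (hk : (2 : k) ≠ 0) (r : ℕ) (hr : 2 ≤ r)
    (g : Fin r → Polynomial k)
    (hdeg : ∀ i, 0 < (g i).natDegree)
    (hsq : ∀ i, ∃ c : k, c ≠ 0 ∧ (g i).eval 0 = c ^ 2)
    (hq : Anisotropic (twistedEntries (k := k) g)) :
    Anisotropic (Sum.elim
      (fun S : Finset (Fin r) =>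
        (∏ i ∈ S, xvar (k := k) (m := r + 1) (Fin.castSucc i)) *
          (if S = Finset.univ then
            ∏ i : Fin r, xvar (k := k) (Fin.castSucc i) * gval (g i) (Fin.castSucc i)
          else 1))
      (fun _ : Unit =>
        -(xvar (k := k) (Fin.last r) ^ 2) - ∏ i : Fin r, xvar (k := k) (Fin.castSucc i))) := by
  have hg (i : Fin r) : (g i).eval 0 ≠ 0 := by
    obtain ⟨c, hc, hgc⟩ := hsq i
    rw [hgc]
    exact pow_ne_zero 2 hc
  have hne : (∅ : Finset (Fin r)) ≠ Finset.univ := by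
    have : Nonempty (Fin r) := ⟨⟨0, by lia⟩⟩
    exact Finset.univ_nonempty.ne_empty.symm
  have h2 : (2 : Km k r) ≠ 0 := by
    rw [← map_ofNat (algebraMap k (Km k r)) 2]
    exact (map_ne_zero_iff _ (algebraMap k (Km k r)).injective).mpr hk
  have hD := anisotropic_of_integral (K := Km k (r + 1)) (D := Sum.elim
    (fun S => MvPolynomial.rename Fin.castSucc (twistedPoly g S))
    (fun _ : Unit => -(MvPolynomial.X (Fin.last r) ^ 2) -
      MvPolynomial.rename Fin.castSucc (∏ i : Fin r, (MvPolynomial.X i : MvPolynomial _ k))))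
    fun w hw => ?_
  · convert hD using 1
    funext i
    rcases i with S | _
    · exact (algebraMap_rename_twistedPoly g S).symm
    · simp [xvar]
  have hw' := congrArg (toPolynomialKm k r) hw
  simp only [Fintype.sum_sum_type, Sum.elim_inl, Sum.elim_inr, map_add, map_sum, map_mul, map_pow,
    map_sub, map_neg, map_zero, toPolynomialKm_X_last, toPolynomialKm_rename,
    algebraMap_twistedPoly, Finset.univ_unique, Finset.sum_singleton] at hw'
  have hv : toPolynomialKm k r (w (Sum.inr default)) = 0 :=
    eq_zero_of_eq_sq_add_mul_sq h2 hq (i₀ := ∅) (by simp [twistedEntries, hne])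
      (anisotropic_update_twistedEntries (by lia) g hg) (fun S => toPolynomialKm k r (w (Sum.inl S)))
      _ (by simp only [xvar, ← map_prod] at hw' ⊢; linear_combination hw')
  rw [hv] at hw'
  have hu := eq_zero_of_anisotropic hq
    (w := fun S => toPolynomialKm k r (w (Sum.inl S))) (by simpa using hw')
  funext i
  apply toPolynomialKm_injective k r
  rcases i with S | _
  · simpa using congrFun hu S
  · simpa using hv

end
end
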